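/- Let k > 2, let R̃ ∈ F^{(k−1)n×(k−1)n} be nonsingular, and let B(λ) = λ[0_{(k−1)n×n} −R̃] + [R̃ 0_{(k−1)n×n}] (i.e. B(λ) = R̃(H_{k−1}(λ)⊗I_n)). If ΔB(λ) ∈ F[λ]^{(k−1)n×kn} is any pencil with ‖ΔB‖_F < 3σ_min(R̃)/(2k^{3/2}), then B(λ) + ΔB(λ) is a minimal basis with all its row degrees equal to 1 and with all the row degrees of any minimal basis dual to it equal to k−1. -/

import Mathlib

noncomputable section

open Polynomial Matrix

namespace GLin

variable {F : Type*} [RCLike F]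

/-! ### Matrix polynomials and pencils -/

/-- The matrix polynomial `P(λ) = ∑_{i=0}^k λ^i A_i` determined by its
coefficient matrices `A_0, …, A_k` (grade `k`). -/
def matPoly {k m n : ℕ} (A : Fin (k + 1) → Matrix (Fin m) (Fin n) F) :
    Matrix (Fin m) (Fin n) F[X] :=
  Matrix.of fun r c => ∑ i : Fin (k + 1), Polynomial.C (A i r c) * Polynomial.X ^ (i : ℕ)

/-- The matrix pencil `L(λ) = λ X + Y`. -/
def pencil {ρ γ : Type*} (Xc Yc : Matrix ρ γ F) : Matrix ρ γ F[X] :=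
  Matrix.of fun i j => Polynomial.C (Xc i j) * Polynomial.X + Polynomial.C (Yc i j)

/-- `Λ_k(λ) ⊗ I_n` where `Λ_k(λ) = (λ^{k-1}, …, λ, 1)ᵀ`. -/
def Lam (F : Type*) [RCLike F] (k n : ℕ) : Matrix (Fin k × Fin n) (Fin n) F[X] :=
  Matrix.of fun p c => if p.2 = c then Polynomial.X ^ (k - 1 - (p.1 : ℕ)) else 0

/-- `Λ_k(λ)ᵀ ⊗ I_m`. -/
def LamRow (F : Type*) [RCLike F] (k m : ℕ) : Matrix (Fin m) (Fin k × Fin m) F[X] :=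
  Matrix.of fun r p => if r = p.2 then Polynomial.X ^ (k - 1 - (p.1 : ℕ)) else 0

/-- `v ⊗ P(λ)`. -/
def vkron {k m n : ℕ} (v : Fin k → F) (P : Matrix (Fin m) (Fin n) F[X]) :
    Matrix (Fin k × Fin m) (Fin n) F[X] :=
  Matrix.of fun p c => Polynomial.C (v p.1) * P p.2 c

/-- `wᵀ ⊗ P(λ)`. -/
def wkron {k m n : ℕ} (w : Fin k → F) (P : Matrix (Fin m) (Fin n) F[X]) :
    Matrix (Fin m) (Fin k × Fin n) F[X] :=
  Matrix.of fun r q => Polynomial.C (w q.1) * P r q.2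

/-- The defining identity of `𝕃₁(P)`: `L(λ)(Λ_k(λ) ⊗ I_n) = v ⊗ P(λ)`. -/
def RightAnsatz {k m n : ℕ} (P : Matrix (Fin m) (Fin n) F[X])
    (L : Matrix (Fin k × Fin m) (Fin k × Fin n) F[X]) (v : Fin k → F) : Prop :=
  L * Lam F k n = vkron v P

/-- The defining identity of `𝕃₂(P)`: `(Λ_k(λ)ᵀ ⊗ I_m) L(λ) = wᵀ ⊗ P(λ)`. -/
def LeftAnsatz {k m n : ℕ} (P : Matrix (Fin m) (Fin n) F[X])
    (L : Matrix (Fin k × Fin m) (Fin k × Fin n) F[X]) (w : Fin k → F) : Prop :=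
  LamRow F k m * L = wkron w P

/-- The vector `α e₁ ∈ F^k`. -/
def e1 {k : ℕ} (α : F) : Fin k → F := fun i => if (i : ℕ) = 0 then α else 0

/-- `M ⊗ I_m`. -/
def kronId {k m : ℕ} (M : Matrix (Fin k) (Fin k) F) :
    Matrix (Fin k × Fin m) (Fin k × Fin m) F :=
  Matrix.of fun p q => if p.2 = q.2 then M p.1 q.1 else 0

/-! ### (strong) g-linearizations -/

/-- `diag(P(λ), I_{k-1} ⊗ I_{m,n})`. -/
def glinTarget {k m n : ℕ} (P : Matrix (Fin m) (Fin n) F[X]) :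
    Matrix (Fin k × Fin m) (Fin k × Fin n) F[X] :=
  Matrix.of fun p q =>
    if p.1 = q.1 then
      (if (p.1 : ℕ) = 0 then P p.2 q.2 else if (p.2 : ℕ) = (q.2 : ℕ) then 1 else 0)
    else 0

/-- A `km × kn` pencil (or matrix polynomial) `L` is a g-linearization of the `m × n`
matrix polynomial `P` of grade `k` if `E(λ) L(λ) G(λ) = diag(P(λ), I_{k-1} ⊗ I_{m,n})`
for unimodular `E`, `G`. -/
def IsGLin {k m n : ℕ} (P : Matrix (Fin m) (Fin n) F[X])
    (L : Matrix (Fin k × Fin m) (Fin k × Fin n) F[X]) : Prop :=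
  ∃ (E : Matrix (Fin k × Fin m) (Fin k × Fin m) F[X])
    (G : Matrix (Fin k × Fin n) (Fin k × Fin n) F[X]),
      IsUnit E.det ∧ IsUnit G.det ∧ E * L * G = glinTarget P

/-- grade-`N` reversal `rev_N P(λ) = λ^N P(1/λ)`, entrywise. -/
def revMat {ρ γ : Type*} (N : ℕ) (P : Matrix ρ γ F[X]) : Matrix ρ γ F[X] :=
  P.map fun p => Polynomial.reflect N p

/-- Strong g-linearization of the grade-`k` matrix polynomial with coefficients `A`. -/
def IsStrongGLin {k m n : ℕ} (A : Fin (k + 1) → Matrix (Fin m) (Fin n) F)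
    (L : Matrix (Fin k × Fin m) (Fin k × Fin n) F[X]) : Prop :=
  IsGLin (matPoly A) L ∧ IsGLin (revMat k (matPoly A)) (revMat 1 L)

/-! ### linearizations (rectangular, of size `(m+s) × (n+s)`) -/

/-- A matrix polynomial `L` (indexed by arbitrary finite types of cardinalities
`m + s` and `n + s`) is a linearization of `P` if, after identifying the index types
with `Fin m ⊕ Fin s` and `Fin n ⊕ Fin s`, one has `E(λ) L(λ) G(λ) = diag(P(λ), I_s)`
for unimodular `E`, `G`. -/
def IsLin {m n : ℕ} (s : ℕ) (P : Matrix (Fin m) (Fin n) F[X])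
    {ρ γ : Type*} [Fintype ρ] [DecidableEq ρ] [Fintype γ] [DecidableEq γ]
    (L : Matrix ρ γ F[X]) : Prop :=
  ∃ (er : ρ ≃ (Fin m ⊕ Fin s)) (ec : γ ≃ (Fin n ⊕ Fin s))
    (E : Matrix (Fin m ⊕ Fin s) (Fin m ⊕ Fin s) F[X])
    (G : Matrix (Fin n ⊕ Fin s) (Fin n ⊕ Fin s) F[X]),
      IsUnit E.det ∧ IsUnit G.det ∧
        E * Matrix.reindex er ec L * G = Matrix.fromBlocks P 0 0 1

/-- Strong linearization of the grade-`k` matrix polynomial with coefficients `A`. -/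
def IsStrongLin {k m n : ℕ} (s : ℕ) (A : Fin (k + 1) → Matrix (Fin m) (Fin n) F)
    {ρ γ : Type*} [Fintype ρ] [DecidableEq ρ] [Fintype γ] [DecidableEq γ]
    (L : Matrix ρ γ F[X]) : Prop :=
  IsLin s (matPoly A) L ∧ IsLin s (revMat k (matPoly A)) (revMat 1 L)

/-! ### shifted sums -/

/-- Column shifted sum `X ⊞→ Y`. -/
def colShiftSum {k m n : ℕ} (Xc Yc : Matrix (Fin k × Fin m) (Fin k × Fin n) F) :
    Matrix (Fin k × Fin m) (Fin (k + 1) × Fin n) F :=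
  Matrix.of fun p q =>
    (if h : (q.1 : ℕ) < k then Xc p (⟨(q.1 : ℕ), h⟩, q.2) else 0) +
    (if h : 0 < (q.1 : ℕ) then
        Yc p (⟨(q.1 : ℕ) - 1, by have := q.1.isLt; omega⟩, q.2)
      else 0)

/-- Row shifted sum `X ⊞↓ Y`. -/
def rowShiftSum {k m n : ℕ} (Xc Yc : Matrix (Fin k × Fin m) (Fin k × Fin n) F) :
    Matrix (Fin (k + 1) × Fin m) (Fin k × Fin n) F :=
  Matrix.of fun p q =>
    (if h : (p.1 : ℕ) < k then Xc (⟨(p.1 : ℕ), h⟩, p.2) q else 0) +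
    (if h : 0 < (p.1 : ℕ) then
        Yc (⟨(p.1 : ℕ) - 1, by have := p.1.isLt; omega⟩, p.2) q
      else 0)

/-! ### the parametrization of `𝕃₁(P)` and `𝕃₂(P)` -/

/-- `X = [v ⊗ A_k ∣ -W]`. -/
def L1X {k m n : ℕ} (A : Fin (k + 1) → Matrix (Fin m) (Fin n) F) (v : Fin k → F)
    (W : Matrix (Fin k × Fin m) (Fin (k - 1) × Fin n) F) :
    Matrix (Fin k × Fin m) (Fin k × Fin n) F :=
  Matrix.of fun p q =>
    if h : (q.1 : ℕ) = 0 then v p.1 * A (Fin.last k) p.2 q.2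
    else -W p (⟨(q.1 : ℕ) - 1, by have := q.1.isLt; omega⟩, q.2)

/-- `Y = [W + v ⊗ [A_{k-1} ⋯ A_1] ∣ v ⊗ A_0]`. -/
def L1Y {k m n : ℕ} (A : Fin (k + 1) → Matrix (Fin m) (Fin n) F) (v : Fin k → F)
    (W : Matrix (Fin k × Fin m) (Fin (k - 1) × Fin n) F) :
    Matrix (Fin k × Fin m) (Fin k × Fin n) F :=
  Matrix.of fun p q =>
    if h : (q.1 : ℕ) < k - 1 then
      W p (⟨(q.1 : ℕ), h⟩, q.2) + v p.1 * A (⟨k - 1 - (q.1 : ℕ), by omega⟩) p.2 q.2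
    else v p.1 * A 0 p.2 q.2

/-- `X = [wᵀ ⊗ A_k ; -Ŵ]`. -/
def L2X {k m n : ℕ} (A : Fin (k + 1) → Matrix (Fin m) (Fin n) F) (w : Fin k → F)
    (W : Matrix (Fin (k - 1) × Fin m) (Fin k × Fin n) F) :
    Matrix (Fin k × Fin m) (Fin k × Fin n) F :=
  Matrix.of fun p q =>
    if h : (p.1 : ℕ) = 0 then w q.1 * A (Fin.last k) p.2 q.2
    else -W (⟨(p.1 : ℕ) - 1, by have := p.1.isLt; omega⟩, p.2) q

/-- `Y = [Ŵ + wᵀ ⊗ [A_{k-1}ᵀ ⋯ A_1ᵀ]ᵀ ; wᵀ ⊗ A_0]`. -/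
def L2Y {k m n : ℕ} (A : Fin (k + 1) → Matrix (Fin m) (Fin n) F) (w : Fin k → F)
    (W : Matrix (Fin (k - 1) × Fin m) (Fin k × Fin n) F) :
    Matrix (Fin k × Fin m) (Fin k × Fin n) F :=
  Matrix.of fun p q =>
    if h : (p.1 : ℕ) < k - 1 then
      W (⟨(p.1 : ℕ), h⟩, p.2) q + w q.1 * A (⟨k - 1 - (p.1 : ℕ), by omega⟩) p.2 q.2
    else w q.1 * A 0 p.2 q.2

/-! ### block structure and `Z`-matrices -/

/-- Assemble a `km × kn` matrix from blocks with row split `m + (k-1)m` and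
column split `n + (k-1)n`. -/
def blk {k m n : ℕ} (TL : Matrix (Fin m) (Fin n) F)
    (TR : Matrix (Fin m) (Fin (k - 1) × Fin n) F)
    (BL : Matrix (Fin (k - 1) × Fin m) (Fin n) F)
    (BR : Matrix (Fin (k - 1) × Fin m) (Fin (k - 1) × Fin n) F) :
    Matrix (Fin k × Fin m) (Fin k × Fin n) F :=
  Matrix.of fun p q =>
    if hp : (p.1 : ℕ) = 0 then
      if hq : (q.1 : ℕ) = 0 then TL p.2 q.2
      else TR p.2 (⟨(q.1 : ℕ) - 1, by have := q.1.isLt; omega⟩, q.2)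
    else
      if hq : (q.1 : ℕ) = 0 then
        BL (⟨(p.1 : ℕ) - 1, by have := p.1.isLt; omega⟩, p.2) q.2
      else
        BR (⟨(p.1 : ℕ) - 1, by have := p.1.isLt; omega⟩, p.2)
          (⟨(q.1 : ℕ) - 1, by have := q.1.isLt; omega⟩, q.2)

/-- Assemble `[[Y₁₁, T],[Z, 0]]`, row split `m + (k-1)m`, column split `(k-1)n + n`. -/
def blkY1 {k m n : ℕ} (Y11 : Matrix (Fin m) (Fin (k - 1) × Fin n) F)
    (T : Matrix (Fin m) (Fin n) F)
    (Z : Matrix (Fin (k - 1) × Fin m) (Fin (k - 1) × Fin n) F) :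
    Matrix (Fin k × Fin m) (Fin k × Fin n) F :=
  Matrix.of fun p q =>
    if hp : (p.1 : ℕ) = 0 then
      if hq : (q.1 : ℕ) < k - 1 then Y11 p.2 (⟨(q.1 : ℕ), hq⟩, q.2) else T p.2 q.2
    else
      if hq : (q.1 : ℕ) < k - 1 then
        Z (⟨(p.1 : ℕ) - 1, by have := p.1.isLt; omega⟩, p.2) (⟨(q.1 : ℕ), hq⟩, q.2)
      else 0

/-- Assemble `[[Y₁₁, Z],[T, 0]]`, row split `(k-1)m + m`, column split `n + (k-1)n`. -/
def blkY2 {k m n : ℕ} (Y11 : Matrix (Fin (k - 1) × Fin m) (Fin n) F)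
    (Z : Matrix (Fin (k - 1) × Fin m) (Fin (k - 1) × Fin n) F)
    (T : Matrix (Fin m) (Fin n) F) :
    Matrix (Fin k × Fin m) (Fin k × Fin n) F :=
  Matrix.of fun p q =>
    if hp : (p.1 : ℕ) < k - 1 then
      if hq : (q.1 : ℕ) = 0 then Y11 (⟨(p.1 : ℕ), hp⟩, p.2) q.2
      else Z (⟨(p.1 : ℕ), hp⟩, p.2) (⟨(q.1 : ℕ) - 1, by have := q.1.isLt; omega⟩, q.2)
    else
      if hq : (q.1 : ℕ) = 0 then T p.2 q.2 else 0

/-- The `Z`-matrix of `L = λX + Y ∈ 𝕃₁(P)` with respect to `M`: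
the lower-left `(k-1)m × (k-1)n` block of `(M ⊗ I_m) Y`. -/
def Zmat1 {k m n : ℕ} (M : Matrix (Fin k) (Fin k) F)
    (Yc : Matrix (Fin k × Fin m) (Fin k × Fin n) F) :
    Matrix (Fin (k - 1) × Fin m) (Fin (k - 1) × Fin n) F :=
  Matrix.of fun p q =>
    (kronId M * Yc : Matrix (Fin k × Fin m) (Fin k × Fin n) F)
      (⟨(p.1 : ℕ) + 1, by have := p.1.isLt; omega⟩, p.2)
      (⟨(q.1 : ℕ), by have := q.1.isLt; omega⟩, q.2)

/-- The `Z`-matrix of `L = λX + Y ∈ 𝕃₂(P)` with respect to `M̂`: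
the upper-right `(k-1)m × (k-1)n` block of `Y (M̂ᵀ ⊗ I_n)`. -/
def Zmat2 {k m n : ℕ} (M : Matrix (Fin k) (Fin k) F)
    (Yc : Matrix (Fin k × Fin m) (Fin k × Fin n) F) :
    Matrix (Fin (k - 1) × Fin m) (Fin (k - 1) × Fin n) F :=
  Matrix.of fun p q =>
    (Yc * kronId Mᵀ : Matrix (Fin k × Fin m) (Fin k × Fin n) F)
      (⟨(p.1 : ℕ), by have := p.1.isLt; omega⟩, p.2)
      (⟨(q.1 : ℕ) + 1, by have := q.1.isLt; omega⟩, q.2)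

/-- `L = λX + Y ∈ 𝕃₁(P)` with right ansatz vector `v` has full `Z`-rank. -/
def FullZrank1 {k m n : ℕ} (Yc : Matrix (Fin k × Fin m) (Fin k × Fin n) F)
    (v : Fin k → F) : Prop :=
  ∃ (M : Matrix (Fin k) (Fin k) F) (α : F),
    IsUnit M ∧ α ≠ 0 ∧ M.mulVec v = e1 α ∧ (Zmat1 M Yc).rank = (k - 1) * n

/-- `L = λX + Y ∈ 𝕃₂(P)` with left ansatz vector `w` has full `Z`-rank. -/
def FullZrank2 {k m n : ℕ} (Yc : Matrix (Fin k × Fin m) (Fin k × Fin n) F)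
    (w : Fin k → F) : Prop :=
  ∃ (M : Matrix (Fin k) (Fin k) F) (α : F),
    IsUnit M ∧ α ≠ 0 ∧ M.mulVec w = e1 α ∧ (Zmat2 M Yc).rank = (k - 1) * m

/-! ### null spaces, minimal bases and minimal indices over `F(λ)` -/

/-- A matrix polynomial viewed as a matrix over the field of rational functions. -/
def matRF {ρ γ : Type*} (P : Matrix ρ γ F[X]) : Matrix ρ γ (RatFunc F) :=
  P.map (algebraMap F[X] (RatFunc F))

/-- The right null space `N_r(P) = {x(λ) : P(λ) x(λ) ≡ 0}` over `F(λ)`. -/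
def Nr {ρ γ : Type*} [Fintype γ] (P : Matrix ρ γ F[X]) :
    Submodule (RatFunc F) (γ → RatFunc F) :=
  LinearMap.ker (Matrix.mulVecLin (matRF P))

/-- The left null space `N_l(P) = {y(λ) : y(λ)ᵀ P(λ) ≡ 0}` over `F(λ)`. -/
def Nl {ρ γ : Type*} [Fintype ρ] (P : Matrix ρ γ F[X]) :
    Submodule (RatFunc F) (ρ → RatFunc F) :=
  Nr Pᵀ

/-- The normal rank of a matrix polynomial: its rank over `F(λ)`. -/
def nrank {ρ γ : Type*} [Fintype γ] (P : Matrix ρ γ F[X]) : ℕ :=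
  (matRF P).rank

/-- The rational vector determined by a vector polynomial. -/
def polyVec {γ : Type*} (x : γ → F[X]) : γ → RatFunc F :=
  fun i => algebraMap F[X] (RatFunc F) (x i)

/-- A rational vector is a vector polynomial if all its entries are polynomials. -/
def IsVecPoly {γ : Type*} (x : γ → RatFunc F) : Prop :=
  ∃ p : γ → F[X], x = polyVec p

/-- The degree of a vector polynomial: the greatest degree of its components. -/
def polyVecDeg {γ : Type*} [Fintype γ] (x : γ → F[X]) : ℕ :=
  Finset.univ.sup fun i => (x i).natDegree

/-- A polynomial basis of the subspace `V` of `F(λ)^γ`. -/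
def IsPolyBasis {γ ι : Type*} [Fintype γ]
    (V : Submodule (RatFunc F) (γ → RatFunc F)) (b : ι → γ → F[X]) : Prop :=
  LinearIndependent (RatFunc F) (fun i => polyVec (b i)) ∧
    Submodule.span (RatFunc F) (Set.range fun i => polyVec (b i)) = V

/-- A minimal basis of `V`: a polynomial basis of least order (sum of degrees). -/
def IsMinimalBasis {γ ι : Type*} [Fintype γ] [Fintype ι]
    (V : Submodule (RatFunc F) (γ → RatFunc F)) (b : ι → γ → F[X]) : Prop :=
  IsPolyBasis V b ∧
    ∀ (d : ℕ) (b' : Fin d → γ → F[X]), IsPolyBasis V b' →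
      ∑ i, polyVecDeg (b i) ≤ ∑ i, polyVecDeg (b' i)

/-- `ε` is the list of minimal indices of `V`: some minimal basis of `V` has
`ε` as its list of degrees. -/
def HasMinIndices {γ : Type*} [Fintype γ]
    (V : Submodule (RatFunc F) (γ → RatFunc F)) {d : ℕ} (ε : Fin d → ℕ) : Prop :=
  ∃ b : Fin d → γ → F[X], IsMinimalBasis V b ∧ ∀ i, polyVecDeg (b i) = ε i

/-- `Λ_k(λ) ⊗ x(λ)`. -/
def lamTensor {n : ℕ} (k : ℕ) (x : Fin n → RatFunc F) : Fin k × Fin n → RatFunc F :=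
  fun p => algebraMap F[X] (RatFunc F) (Polynomial.X ^ (k - 1 - (p.1 : ℕ))) * x p.2

/-- The matrix `vᵀ ⊗ I_m` over `F(λ)`; `𝓛_v(y) = (vproj v).mulVec y`. -/
def vproj {k m : ℕ} (v : Fin k → F) : Matrix (Fin m) (Fin k × Fin m) (RatFunc F) :=
  Matrix.of fun r p =>
    if r = p.2 then algebraMap F[X] (RatFunc F) (Polynomial.C (v p.1)) else 0

/-- `(vᵀ ⊗ I_m) y` at the level of vector polynomials. -/
def LvPoly {k m : ℕ} (v : Fin k → F) (y : Fin k × Fin m → F[X]) : Fin m → F[X] :=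
  fun r => ∑ i : Fin k, Polynomial.C (v i) * y (i, r)

/-- The rational subspace spanned by the rows of a matrix polynomial. -/
def rowSpan {ρ γ : Type*} [Fintype γ] (B : Matrix ρ γ F[X]) :
    Submodule (RatFunc F) (γ → RatFunc F) :=
  Submodule.span (RatFunc F) (Set.range fun i => polyVec (B i))

/-- A matrix polynomial is a minimal basis if its rows form a minimal basis of the
rational subspace they span. -/
def IsMinimalBasisMat {ρ γ : Type*} [Fintype ρ] [Fintype γ] (B : Matrix ρ γ F[X]) : Prop :=
  IsMinimalBasis (rowSpan B) (fun i => B i)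

/-- Dual minimal bases: `B ∈ F[λ]^{n₁×n}`, `C ∈ F[λ]^{n₂×n}` minimal bases with
`n₁ + n₂ = n` and `B Cᵀ = 0`. -/
def DualMinBases {ρ ρ' γ : Type*} [Fintype ρ] [Fintype ρ'] [Fintype γ]
    (B : Matrix ρ γ F[X]) (Cm : Matrix ρ' γ F[X]) : Prop :=
  IsMinimalBasisMat B ∧ IsMinimalBasisMat Cm ∧
    Fintype.card ρ + Fintype.card ρ' = Fintype.card γ ∧ B * Cmᵀ = 0

/-! ### norms, singular values -/

/-- Square of the Frobenius norm of a constant matrix. -/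
def frobSq {ρ γ : Type*} [Fintype ρ] [Fintype γ] (Ac : Matrix ρ γ F) : ℝ :=
  ∑ i, ∑ j, ‖Ac i j‖ ^ 2

/-- `‖λX + Y‖_F = sqrt(‖X‖_F² + ‖Y‖_F²)`. -/
def penFrob {ρ γ : Type*} [Fintype ρ] [Fintype γ] (Xc Yc : Matrix ρ γ F) : ℝ :=
  Real.sqrt (frobSq Xc + frobSq Yc)

/-- `‖P‖_F = sqrt(∑ ‖A_i‖_F²)` for `P(λ) = ∑ λ^i A_i`. -/
def famFrob {k m n : ℕ} (A : Fin (k + 1) → Matrix (Fin m) (Fin n) F) : ℝ :=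
  Real.sqrt (∑ i, frobSq (A i))

/-- `‖P‖_F` for a matrix polynomial of grade `g`. -/
def mpolyFrob {ρ γ : Type*} [Fintype ρ] [Fintype γ] (g : ℕ) (P : Matrix ρ γ F[X]) : ℝ :=
  Real.sqrt (∑ i, ∑ j, ∑ d ∈ Finset.range (g + 1), ‖(P i j).coeff d‖ ^ 2)

/-- Square of the Euclidean norm of a vector. -/
def vecNormSq {ι : Type*} [Fintype ι] (x : ι → F) : ℝ := ∑ i, ‖x i‖ ^ 2

/-- The smallest singular value of a matrix. -/
def sigmaMin {ρ γ : Type*} [Fintype ρ] [Fintype γ] (Ac : Matrix ρ γ F) : ℝ :=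
  if Fintype.card γ ≤ Fintype.card ρ then
    sInf {r : ℝ | ∃ x : γ → F, vecNormSq x = 1 ∧ r = Real.sqrt (vecNormSq (Ac.mulVec x))}
  else
    sInf {r : ℝ | ∃ y : ρ → F, vecNormSq y = 1 ∧ r = Real.sqrt (vecNormSq (Acᴴ.mulVec y))}

/-- The spectral norm (2-norm) of a matrix. -/
def norm2 {ρ γ : Type*} [Fintype ρ] [Fintype γ] (Ac : Matrix ρ γ F) : ℝ :=
  sSup {r : ℝ | ∃ x : γ → F, vecNormSq x = 1 ∧ r = Real.sqrt (vecNormSq (Ac.mulVec x))}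

/-- `κ₂(D) = ‖D‖₂ ‖D⁻¹‖₂`. -/
def cond2 {ρ : Type*} [Fintype ρ] [DecidableEq ρ] (Dc : Matrix ρ ρ F) : ℝ :=
  norm2 Dc * norm2 Dc⁻¹

/-! ### pencils used in the backward error analysis -/

/-- `B(λ) = λ [0 ∣ -R̃] + [R̃ ∣ 0]`, i.e. `R̃ (H_{k-1}(λ) ⊗ I_n)` up to sign conventions. -/
def Bpencil {k n : ℕ} (R : Matrix (Fin (k - 1) × Fin n) (Fin (k - 1) × Fin n) F) :
    Matrix (Fin (k - 1) × Fin n) (Fin k × Fin n) F[X] :=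
  Matrix.of fun p q =>
    (if h : (q.1 : ℕ) < k - 1 then Polynomial.C (R p (⟨(q.1 : ℕ), h⟩, q.2)) else 0) +
    (if h : 0 < (q.1 : ℕ) then
        Polynomial.X *
          Polynomial.C (-R p (⟨(q.1 : ℕ) - 1, by have := q.1.isLt; omega⟩, q.2))
      else 0)

/-- The coefficient of `λ` in `H_{k-1}(λ) ⊗ I_n`. -/
def Hlam (F : Type*) [RCLike F] (k n : ℕ) :
    Matrix (Fin (k - 1) × Fin n) (Fin k × Fin n) F :=
  Matrix.of fun p q => if p.2 = q.2 ∧ (q.1 : ℕ) = (p.1 : ℕ) + 1 then 1 else 0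

/-- The constant coefficient of `H_{k-1}(λ) ⊗ I_n`. -/
def Hconst (F : Type*) [RCLike F] (k n : ℕ) :
    Matrix (Fin (k - 1) × Fin n) (Fin k × Fin n) F :=
  Matrix.of fun p q => if p.2 = q.2 ∧ (q.1 : ℕ) = (p.1 : ℕ) then -1 else 0

/-- The convolution matrix `C_j(λ Xc + Yc)` of a pencil, with `j+1` block columns. -/
def convPencil {ρ γ : Type*} (Xc Yc : Matrix ρ γ F) (j : ℕ) :
    Matrix (Fin (j + 2) × ρ) (Fin (j + 1) × γ) F :=
  Matrix.of fun r c =>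
    if (r.1 : ℕ) = (c.1 : ℕ) then Xc r.2 c.2
    else if (r.1 : ℕ) = (c.1 : ℕ) + 1 then Yc r.2 c.2 else 0

/-- λ-coefficient of the trimmed pencil `L̂_t(λ)`:
`[[α A_k, X₁₂],[0, -R̃]]` with row split `m + (k-1)n`. -/
def LtX {k m n : ℕ} (α : F) (Ak : Matrix (Fin m) (Fin n) F)
    (X12 : Matrix (Fin m) (Fin (k - 1) × Fin n) F)
    (R : Matrix (Fin (k - 1) × Fin n) (Fin (k - 1) × Fin n) F) :
    Matrix (Fin m ⊕ (Fin (k - 1) × Fin n)) (Fin k × Fin n) F :=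
  Matrix.of fun s q =>
    Sum.elim
      (fun r => if h : (q.1 : ℕ) = 0 then α * Ak r q.2
        else X12 r (⟨(q.1 : ℕ) - 1, by have := q.1.isLt; omega⟩, q.2))
      (fun p => if h : (q.1 : ℕ) = 0 then 0
        else -R p (⟨(q.1 : ℕ) - 1, by have := q.1.isLt; omega⟩, q.2)) s

/-- Constant coefficient of the trimmed pencil `L̂_t(λ)`:
`[[Y₁₁, α A₀],[R̃, 0]]` with row split `m + (k-1)n`. -/
def LtY {k m n : ℕ} (α : F) (A0 : Matrix (Fin m) (Fin n) F)
    (Y11 : Matrix (Fin m) (Fin (k - 1) × Fin n) F)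
    (R : Matrix (Fin (k - 1) × Fin n) (Fin (k - 1) × Fin n) F) :
    Matrix (Fin m ⊕ (Fin (k - 1) × Fin n)) (Fin k × Fin n) F :=
  Matrix.of fun s q =>
    Sum.elim
      (fun r => if h : (q.1 : ℕ) < k - 1 then Y11 r (⟨(q.1 : ℕ), h⟩, q.2)
        else α * A0 r q.2)
      (fun p => if h : (q.1 : ℕ) < k - 1 then R p (⟨(q.1 : ℕ), h⟩, q.2) else 0) s

/-! ### trimming -/

/-- The rows `[0 ∣ Q₂*] (M ⊗ I_m)`. -/
def bottomRows {k m n c : ℕ} (M : Matrix (Fin k) (Fin k) F)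
    (Q : Matrix (Fin (k - 1) × Fin m) ((Fin (k - 1) × Fin n) ⊕ Fin c) F) :
    Matrix (Fin c) (Fin k × Fin m) F :=
  (Matrix.of fun (j : Fin c) (p : Fin k × Fin m) =>
      if h : (p.1 : ℕ) = 0 then 0
      else star (Q (⟨(p.1 : ℕ) - 1, by have := p.1.isLt; omega⟩, p.2) (Sum.inr j)))
    * kronId M

/-- The square matrix `[D ; [0 ∣ Q₂*](M ⊗ I_m)]` whose invertibility makes `D` admissible. -/
def trimAux {k m n c : ℕ} (M : Matrix (Fin k) (Fin k) F)
    (Q : Matrix (Fin (k - 1) × Fin m) ((Fin (k - 1) × Fin n) ⊕ Fin c) F)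
    (D : Matrix (Fin m ⊕ (Fin (k - 1) × Fin n)) (Fin k × Fin m) F) :
    Matrix ((Fin m ⊕ (Fin (k - 1) × Fin n)) ⊕ Fin c) (Fin k × Fin m) F :=
  Matrix.of (Sum.elim (fun i j => D i j) (fun i j => bottomRows M Q i j))

/-- The columns `(M̂ᵀ ⊗ I_n) [0 ; Q₂]`. -/
def rightCols {k m n c : ℕ} (M : Matrix (Fin k) (Fin k) F)
    (Q : Matrix (Fin (k - 1) × Fin n) ((Fin (k - 1) × Fin m) ⊕ Fin c) F) :
    Matrix (Fin k × Fin n) (Fin c) F :=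
  kronId Mᵀ *
    (Matrix.of fun (q : Fin k × Fin n) (j : Fin c) =>
      if h : (q.1 : ℕ) = 0 then 0
      else Q (⟨(q.1 : ℕ) - 1, by have := q.1.isLt; omega⟩, q.2) (Sum.inr j))

/-- The square matrix `[D̂ ∣ (M̂ᵀ ⊗ I_n)[0 ; Q₂]]` whose invertibility makes `D̂` admissible. -/
def trimAux2 {k m n c : ℕ} (M : Matrix (Fin k) (Fin k) F)
    (Q : Matrix (Fin (k - 1) × Fin n) ((Fin (k - 1) × Fin m) ⊕ Fin c) F)
    (D : Matrix (Fin k × Fin n) (Fin n ⊕ (Fin (k - 1) × Fin m)) F) :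
    Matrix (Fin k × Fin n) ((Fin n ⊕ (Fin (k - 1) × Fin m)) ⊕ Fin c) F :=
  Matrix.of fun q s => Sum.elim (fun t => D q t) (fun j => rightCols M Q q j) s
/-! ### pencils whose convolution map is injective -/

section Pencil

variable {ρ γ : Type*}

lemma coeff_pencil_mulVec_zero [Fintype γ] (Xc Yc : Matrix ρ γ F) (x : γ → F[X]) (i : ρ) :
    ((pencil Xc Yc *ᵥ x) i).coeff 0 = (Yc *ᵥ fun j => (x j).coeff 0) i := by
  simp [pencil, Matrix.mulVec, dotProduct, add_mul, mul_assoc]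

lemma coeff_pencil_mulVec_succ [Fintype γ] (Xc Yc : Matrix ρ γ F) (x : γ → F[X]) (i : ρ) (r : ℕ) :
    ((pencil Xc Yc *ᵥ x) i).coeff (r + 1) =
      (Xc *ᵥ fun j => (x j).coeff r) i + (Yc *ᵥ fun j => (x j).coeff (r + 1)) i := by
  simp [pencil, Matrix.mulVec, dotProduct, add_mul, mul_assoc, coeff_X_mul,
    Finset.sum_add_distrib]

lemma coeff_vecMul_pencil_succ [Fintype ρ] (Xc Yc : Matrix ρ γ F) (u : ρ → F[X]) (j : γ) (r : ℕ) :
    ((u ᵥ* pencil Xc Yc) j).coeff (r + 1) =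
      ((fun i => (u i).coeff r) ᵥ* Xc) j + ((fun i => (u i).coeff (r + 1)) ᵥ* Yc) j := by
  simp only [pencil, Matrix.vecMul, dotProduct, Matrix.of_apply, finsetSum_coeff,
    ← Finset.sum_add_distrib]
  refine Finset.sum_congr rfl fun i _ => ?_
  rw [mul_add, coeff_add, ← mul_assoc, coeff_mul_X, coeff_mul_C, coeff_mul_C]

/-- Multiplication by a pencil raises the degree bound by one. -/
lemma degree_pencil_mulVec_lt [Fintype γ] (Xc Yc : Matrix ρ γ F) {N : ℕ} {x : γ → F[X]}
    (hx : ∀ j, (x j).degree < N) (i : ρ) :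
    ((pencil Xc Yc *ᵥ x) i).degree < (N + 1 : ℕ) := by
  rw [degree_lt_iff_coeff_zero]
  intro r hr
  have hx' : ∀ j s, N ≤ s → (x j).coeff s = 0 := fun j s hs =>
    (degree_lt_iff_coeff_zero _ _).1 (hx j) s hs
  obtain ⟨s, rfl⟩ : ∃ s, r = s + 1 := ⟨r - 1, by omega⟩
  rw [coeff_pencil_mulVec_succ]
  simp only [hx' _ s (by omega), hx' _ (s + 1) (by omega)]
  simp [Matrix.mulVec, dotProduct]

/-- Multiplication by a pencil, restricted to vector polynomials of degree less than `N`. -/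
def convMap [Fintype γ] (Xc Yc : Matrix ρ γ F) (N : ℕ) :
    (γ → degreeLT F N) →ₗ[F] (ρ → degreeLT F (N + 1)) where
  toFun x i := ⟨(pencil Xc Yc *ᵥ fun j => (x j : F[X])) i, mem_degreeLT.2
    (degree_pencil_mulVec_lt Xc Yc (fun j => mem_degreeLT.1 (x j).2) i)⟩
  map_add' x y := by
    ext1 i
    apply Subtype.ext
    simp [Matrix.mulVec, dotProduct, mul_add, Finset.sum_add_distrib]
  map_smul' c x := by
    ext1 i
    apply Subtype.ext
    simp [Matrix.mulVec, dotProduct, Finset.smul_sum]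

lemma coe_convMap [Fintype γ] (Xc Yc : Matrix ρ γ F) (N : ℕ) (x : γ → degreeLT F N) (i : ρ) :
    (convMap Xc Yc N x i : F[X]) = (pencil Xc Yc *ᵥ fun j => (x j : F[X])) i := rfl

lemma finrank_pi_degreeLT (F : Type*) [RCLike F] (ι : Type*) [Fintype ι] (N : ℕ) :
    Module.finrank F (ι → degreeLT F N) = Fintype.card ι * N := by
  have h : Module.finrank F (degreeLT F N) = N := by
    rw [(degreeLTEquiv F N).finrank_eq, Module.finrank_fin_fun]
  have : Module.Finite F (degreeLT F N) := Module.Finite.equiv (degreeLTEquiv F N).symm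
  rw [Module.finrank_pi_fintype]
  simp [h]

instance (F : Type*) [RCLike F] (N : ℕ) : Module.Finite F (degreeLT F N) :=
  Module.Finite.equiv (degreeLTEquiv F N).symm

/-- `λX + Y` annihilates no nonzero vector polynomial of degree less than `N`. -/
def ConvInjective [Fintype γ] (Xc Yc : Matrix ρ γ F) (N : ℕ) : Prop :=
  ∀ x : γ → F[X], (∀ j, (x j).degree < N) → pencil Xc Yc *ᵥ x = 0 → x = 0

variable {Xc Yc : Matrix ρ γ F} {N : ℕ}

lemma ConvInjective.exists_mulVec_eq [Fintype γ] [Fintype ρ] (hinj : ConvInjective Xc Yc N)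
    (hcard : Fintype.card γ * N = Fintype.card ρ * (N + 1)) (y : ρ → F[X])
    (hy : ∀ i, (y i).degree < (N + 1 : ℕ)) :
    ∃ x : γ → F[X], (∀ j, (x j).degree < N) ∧ pencil Xc Yc *ᵥ x = y := by
  have hi : Function.Injective (convMap Xc Yc N) := by
    rw [injective_iff_map_eq_zero]
    intro x hx
    have := hinj (fun j => (x j : F[X])) (fun j => mem_degreeLT.1 (x j).2) (by
      ext1 i
      rw [← coe_convMap, hx]
      rfl)
    ext1 j
    exact Subtype.ext (congrFun this j)
  have hs : Function.Surjective (convMap Xc Yc N) :=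
    (LinearMap.injective_iff_surjective_of_finrank_eq_finrank (by
      rw [finrank_pi_degreeLT, finrank_pi_degreeLT, hcard])).1 hi
  obtain ⟨x, hx⟩ := hs fun i => ⟨y i, mem_degreeLT.2 (hy i)⟩
  refine ⟨fun j => x j, fun j => mem_degreeLT.1 (x j).2, ?_⟩
  ext1 i
  rw [← coe_convMap, hx]

lemma ConvInjective.exists_right_inverse [Fintype γ] [Fintype ρ] [DecidableEq ρ] (hinj : ConvInjective Xc Yc N)
    (hcard : Fintype.card γ * N = Fintype.card ρ * (N + 1)) :
    ∃ G : Matrix γ ρ F[X], pencil Xc Yc * G = 1 := by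
  have h : ∀ i : ρ, ∃ x : γ → F[X], pencil Xc Yc *ᵥ x = Pi.single i 1 := by
    intro i
    obtain ⟨x, -, hx⟩ := hinj.exists_mulVec_eq hcard (Pi.single i 1) (by
      intro i'
      rcases eq_or_ne i' i with rfl | h
      · simp only [Pi.single_eq_same, degree_one]
        exact_mod_cast Nat.succ_pos N
      · simp [Pi.single_eq_of_ne h, bot_lt_iff_ne_bot])
    exact ⟨x, hx⟩
  choose g hg using h
  refine ⟨Matrix.of fun j i => g i j, ?_⟩
  refine Matrix.ext fun i i' => ?_
  have := congrFun (hg i') i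
  rw [Matrix.one_apply, Matrix.mul_apply]
  simpa [Matrix.mulVec, dotProduct, Pi.single_apply] using this

lemma ConvInjective.exists_lead_right_inverse [Fintype γ] [Fintype ρ] [DecidableEq ρ] (hinj : ConvInjective Xc Yc N)
    (hN : 0 < N) (hcard : Fintype.card γ * N = Fintype.card ρ * (N + 1)) :
    ∃ V : Matrix γ ρ F, Xc * V = 1 := by
  obtain ⟨M, rfl⟩ : ∃ M, N = M + 1 := ⟨N - 1, by omega⟩
  have h : ∀ i : ρ, ∃ v : γ → F, Xc *ᵥ v = Pi.single i 1 := by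
    intro i
    obtain ⟨x, hx, hxi⟩ := hinj.exists_mulVec_eq hcard (Pi.single i (X ^ (M + 1))) (by
      intro i'
      rcases eq_or_ne i' i with rfl | h
      · simp only [Pi.single_eq_same, degree_X_pow]
        exact_mod_cast Nat.lt_succ_self (M + 1)
      · simp [Pi.single_eq_of_ne h, bot_lt_iff_ne_bot])
    refine ⟨fun j => (x j).coeff M, ?_⟩
    ext1 i'
    have h1 := coeff_pencil_mulVec_succ Xc Yc x i' M
    have h2 : ∀ j, (x j).coeff (M + 1) = 0 := fun j =>
      (degree_lt_iff_coeff_zero _ _).1 (hx j) _ le_rfl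
    have h3 : (Yc *ᵥ fun j => (x j).coeff (M + 1)) i' = 0 := by
      simp [h2, Matrix.mulVec, dotProduct]
    rw [h3, add_zero, hxi] at h1
    rw [← h1]
    rcases eq_or_ne i' i with rfl | h
    · simp
    · simp [Pi.single_eq_of_ne h]
  choose g hg using h
  refine ⟨Matrix.of fun j i => g i j, ?_⟩
  refine Matrix.ext fun i i' => ?_
  have := congrFun (hg i') i
  rw [Matrix.one_apply, Matrix.mul_apply]
  simpa [Matrix.mulVec, dotProduct, Pi.single_apply] using this

end Pencil

lemma polyVecDeg_le_iff {γ : Type*} [Fintype γ] {x : γ → F[X]} {N : ℕ} :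
    polyVecDeg x ≤ N ↔ ∀ j, (x j).natDegree ≤ N := by
  simp [polyVecDeg]

lemma polyVecDeg_lt_iff {γ : Type*} [Fintype γ] {x : γ → F[X]} {N : ℕ} (hN : 0 < N) :
    polyVecDeg x < N ↔ ∀ j, (x j).degree < N := by
  rw [polyVecDeg, Finset.sup_lt_iff (by simpa using hN)]
  simp only [Finset.mem_univ, true_imp_iff]
  refine forall_congr' fun j => ?_
  rcases eq_or_ne (x j) 0 with h | h
  · simp [h, hN, bot_lt_iff_ne_bot]
  · exact natDegree_lt_iff_degree_lt h

lemma polyVec_injective {γ : Type*} : Function.Injective (polyVec : (γ → F[X]) → _) := by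
  intro x y h
  ext1 j
  exact RatFunc.algebraMap_injective F (congrFun h j)

lemma polyVec_vecMul {ρ γ : Type*} [Fintype ρ] (u : ρ → F[X]) (A : Matrix ρ γ F[X]) :
    polyVec (u ᵥ* A) = polyVec u ᵥ* matRF A := by
  ext1 j
  simp [polyVec, matRF, Matrix.vecMul, dotProduct]

lemma polyVec_mulVec {ρ γ : Type*} [Fintype γ] (A : Matrix ρ γ F[X]) (x : γ → F[X]) :
    polyVec (A *ᵥ x) = matRF A *ᵥ polyVec x := by
  ext1 j
  simp [polyVec, matRF, Matrix.mulVec, dotProduct]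

lemma matRF_mul_eq_one {ρ γ : Type*} [Fintype γ] [DecidableEq ρ] {A : Matrix ρ γ F[X]}
    {G : Matrix γ ρ F[X]} (h : A * G = 1) : matRF A * matRF G = 1 := by
  rw [matRF, matRF, ← Matrix.map_mul, h, Matrix.map_one _ (map_zero _) (map_one _)]

/-- A nonzero finite family of polynomials has a largest exponent that occurs in it. -/
lemma exists_lead_coeff {ι : Type*} [Fintype ι] {u : ι → F[X]} (hu : u ≠ 0) :
    ∃ D : ℕ, (∃ i, (u i).coeff D ≠ 0) ∧ ∀ i r, D < r → (u i).coeff r = 0 := by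
  obtain ⟨i₀, hi₀⟩ := Function.ne_iff.1 hu
  let s := Finset.univ.filter fun i => u i ≠ 0
  obtain ⟨i, his, hmax⟩ := s.exists_max_image (fun i => (u i).natDegree)
    ⟨i₀, by simpa [s] using hi₀⟩
  refine ⟨(u i).natDegree, ⟨i, ?_⟩, fun j r hr => ?_⟩
  · simpa [s] using his
  · by_cases hj : u j = 0
    · simp [hj]
    · exact coeff_eq_zero_of_natDegree_lt ((hmax j (by simpa [s] using hj)).trans_lt hr)

section Pencil

variable {ρ γ : Type*} {Xc Yc : Matrix ρ γ F} {N : ℕ}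

lemma one_le_polyVecDeg_vecMul_pencil [Fintype γ] [Fintype ρ] [DecidableEq ρ] {V : Matrix γ ρ F} (hV : Xc * V = 1)
    {u : ρ → F[X]} (hu : u ≠ 0) : 1 ≤ polyVecDeg (u ᵥ* pencil Xc Yc) := by
  by_contra hlt
  have hdeg : polyVecDeg (u ᵥ* pencil Xc Yc) ≤ 0 := by omega
  obtain ⟨D, ⟨i, hi⟩, hD⟩ := exists_lead_coeff hu
  have h0 : (fun i => (u i).coeff D) ᵥ* Xc = 0 := by
    ext1 j
    have h1 := coeff_vecMul_pencil_succ Xc Yc u j D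
    have h2 : ((fun i => (u i).coeff (D + 1)) ᵥ* Yc) j = 0 := by
      simp [hD _ (D + 1) (Nat.lt_succ_self D), Matrix.vecMul, dotProduct]
    rw [h2, add_zero, coeff_eq_zero_of_natDegree_lt
      ((polyVecDeg_le_iff.1 hdeg j).trans_lt (Nat.succ_pos D))] at h1
    exact h1.symm
  have h3 : (fun i => (u i).coeff D) = 0 := by
    rw [← Matrix.vecMul_one (fun i => (u i).coeff D), ← hV, ← Matrix.vecMul_vecMul, h0,
      Matrix.zero_vecMul]
  exact hi (congrFun h3 i)

lemma row_eq_single_vecMul [Fintype ρ] [DecidableEq ρ] (A : Matrix ρ γ F[X]) (i : ρ) :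
    A i = Pi.single i 1 ᵥ* A := by
  rw [Matrix.single_one_vecMul]
  rfl

lemma polyVecDeg_pencil_row [Fintype γ] [Fintype ρ] [DecidableEq ρ] {V : Matrix γ ρ F} (hV : Xc * V = 1) (i : ρ) :
    polyVecDeg (pencil Xc Yc i) = 1 := by
  apply le_antisymm
  · rw [polyVecDeg_le_iff]
    intro j
    exact natDegree_linear_le
  · rw [row_eq_single_vecMul (pencil Xc Yc) i]
    exact one_le_polyVecDeg_vecMul_pencil hV (by simp)

lemma linearIndependent_rows_of_mul_eq_one [Fintype γ] [Fintype ρ] [DecidableEq ρ] {A : Matrix ρ γ F[X]}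
    {G : Matrix γ ρ F[X]} (hG : A * G = 1) :
    LinearIndependent (RatFunc F) fun i => polyVec (A i) := by
  have : Function.Injective (matRF A).vecMul := by
    intro u v huv
    have := congrArg (fun w => w ᵥ* matRF G) huv
    simpa [Matrix.vecMul_vecMul, matRF_mul_eq_one hG] using this
  exact Matrix.vecMul_injective_iff.1 this

lemma exists_eq_vecMul_of_mem_rowSpan [Fintype γ] [Fintype ρ] [DecidableEq ρ] {A : Matrix ρ γ F[X]}
    {G : Matrix γ ρ F[X]} (hG : A * G = 1) {b : γ → F[X]} (hb : polyVec b ∈ rowSpan A) :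
    ∃ u : ρ → F[X], b = u ᵥ* A := by
  refine ⟨b ᵥ* G, polyVec_injective ?_⟩
  obtain ⟨c, hc⟩ := (Submodule.mem_span_range_iff_exists_fun _).1 hb
  have hc' : polyVec b = c ᵥ* matRF A := by
    rw [← hc, Matrix.vecMul_eq_sum]
    rfl
  rw [polyVec_vecMul, polyVec_vecMul, hc', Matrix.vecMul_vecMul, Matrix.vecMul_vecMul,
    ← Matrix.mul_assoc, matRF_mul_eq_one hG, Matrix.one_mul]

/-- A pencil with a polynomial right inverse and a leading coefficient of full row rank is a
minimal basis. -/
lemma isMinimalBasisMat_pencil [Fintype γ] [Fintype ρ] [DecidableEq ρ] {V : Matrix γ ρ F} (hV : Xc * V = 1)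
    {G : Matrix γ ρ F[X]} (hG : pencil Xc Yc * G = 1) :
    IsMinimalBasisMat (pencil Xc Yc) := by
  have hli := linearIndependent_rows_of_mul_eq_one hG
  refine ⟨⟨hli, rfl⟩, fun d b' hb' => ?_⟩
  have hd : d = Fintype.card ρ := by
    have h1 := finrank_span_eq_card hb'.1
    have h2 := finrank_span_eq_card hli
    rw [hb'.2, rowSpan, h2, Fintype.card_fin] at h1
    exact h1.symm
  have hdeg : ∀ i, 1 ≤ polyVecDeg (b' i) := by
    intro i
    obtain ⟨u, hu⟩ := exists_eq_vecMul_of_mem_rowSpan hG (b := b' i) (by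
      rw [← hb'.2]
      exact Submodule.subset_span ⟨i, rfl⟩)
    rw [hu]
    refine one_le_polyVecDeg_vecMul_pencil hV fun h0 => hb'.1.ne_zero i ?_
    rw [hu, h0, Matrix.zero_vecMul]
    ext1 j
    simp [polyVec]
  calc ∑ i, polyVecDeg (pencil Xc Yc i) = ∑ _i : Fin d, 1 := by
        simp [polyVecDeg_pencil_row hV, hd]
    _ ≤ ∑ i, polyVecDeg (b' i) := Finset.sum_le_sum fun i _ => hdeg i

lemma finrank_Nr_of_mul_eq_one [Fintype γ] [Fintype ρ] [DecidableEq ρ] {A : Matrix ρ γ F[X]} {G : Matrix γ ρ F[X]}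
    (hG : A * G = 1) :
    Fintype.card ρ + Module.finrank (RatFunc F) (Nr A) = Fintype.card γ := by
  have hs : LinearMap.range (matRF A).mulVecLin = ⊤ := by
    rw [LinearMap.range_eq_top]
    intro y
    exact ⟨matRF G *ᵥ y, by simp [Matrix.mulVec_mulVec, matRF_mul_eq_one hG]⟩
  have h := LinearMap.finrank_range_add_finrank_ker (matRF A).mulVecLin
  rwa [hs, finrank_top, Module.finrank_fintype_fun_eq_card,
    Module.finrank_fintype_fun_eq_card] at h

lemma polyVec_mem_Nr [Fintype γ] {A : Matrix ρ γ F[X]} {x : γ → F[X]} (h : A *ᵥ x = 0) :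
    polyVec x ∈ Nr A := by
  rw [Nr, LinearMap.mem_ker, Matrix.mulVecLin_apply, ← polyVec_mulVec, h]
  ext1 j
  simp [polyVec]

/-- Vectors of degree at most `N` in the kernel are independent over `F(λ)` as soon as they are
independent over `F`, because no kernel vector has degree less than `N`. -/
lemma ConvInjective.linearIndependent_polyVec [Fintype γ] (hinj : ConvInjective Xc Yc N)
    {ι : Type*} [Fintype ι] {b : ι → γ → F[X]} (hb : LinearIndependent F b)
    (hdeg : ∀ i j, (b i j).natDegree ≤ N) (hker : ∀ i, pencil Xc Yc *ᵥ b i = 0) :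
    LinearIndependent (RatFunc F) fun i => polyVec (b i) := by
  rw [← LinearIndependent.iff_fractionRing F[X] (RatFunc F), Fintype.linearIndependent_iff]
  intro g hg
  have hsum : ∀ j, ∑ i, g i * b i j = 0 := by
    intro j
    apply RatFunc.algebraMap_injective F
    have := congrFun hg j
    simpa [polyVec, Algebra.smul_def] using this
  by_contra! hne
  obtain ⟨D, ⟨i, hi⟩, hD⟩ := exists_lead_coeff (u := g)
    (Function.ne_iff.2 hne)
  apply hi
  refine (Fintype.linearIndependent_iff.1 hb) (fun i => (g i).coeff D) ?_ i
  apply hinj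
  · intro j
    rw [degree_lt_iff_coeff_zero]
    intro r hr
    simp only [Finset.sum_apply, Pi.smul_apply, finsetSum_coeff, coeff_smul, smul_eq_mul]
    rcases hr.eq_or_lt with rfl | hr
    · have := congrArg (fun p => p.coeff (D + N)) (hsum j)
      simp only [finsetSum_coeff, coeff_zero] at this
      rw [← this]
      refine Finset.sum_congr rfl fun i _ => ?_
      refine (coeff_mul_add_eq_of_natDegree_le ?_ (hdeg i j)).symm
      rw [natDegree_le_iff_coeff_eq_zero]
      exact fun r hr => hD i r hr
    · refine Finset.sum_eq_zero fun i _ => ?_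
      rw [coeff_eq_zero_of_natDegree_lt ((hdeg i j).trans_lt hr), mul_zero]
  · rw [Matrix.mulVec_sum]
    refine Finset.sum_eq_zero fun i _ => ?_
    rw [Matrix.mulVec_smul, hker i, smul_zero]

lemma exists_linearIndependent_ker {K V W : Type*} [Field K] [AddCommGroup V] [Module K V]
    [AddCommGroup W] [Module K W] [Module.Finite K V] [Module.Finite K W] (f : V →ₗ[K] W) {d : ℕ}
    (hd : d + Module.finrank K W ≤ Module.finrank K V) :
    ∃ b : Fin d → V, LinearIndependent K b ∧ ∀ i, f (b i) = 0 := by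
  have hfin : d ≤ Module.finrank K (LinearMap.ker f) := by
    have h1 := LinearMap.finrank_range_add_finrank_ker f
    have h2 := Submodule.finrank_le (LinearMap.range f)
    omega
  obtain ⟨b, hb⟩ := exists_linearIndependent_of_le_finrank hfin
  exact ⟨fun i => b i, hb.map' (LinearMap.ker f).subtype (Submodule.ker_subtype _),
    fun i => (b i).2⟩

lemma exists_kernel_family [Fintype γ] [Fintype ρ] (Xc Yc : Matrix ρ γ F) {d : ℕ}
    (hcard : Fintype.card γ * N = Fintype.card ρ * (N + 1))
    (hd : Fintype.card ρ + d = Fintype.card γ) :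
    ∃ b : Fin d → γ → F[X], LinearIndependent F b ∧ (∀ i j, (b i j).natDegree ≤ N) ∧
      ∀ i, pencil Xc Yc *ᵥ b i = 0 := by
  obtain ⟨f, hf, hker⟩ := exists_linearIndependent_ker (convMap Xc Yc (N + 1)) (d := d) (by
    rw [finrank_pi_degreeLT, finrank_pi_degreeLT]
    nlinarith)
  refine ⟨fun i j => (f i j : F[X]), ?_, fun i j => ?_, fun i => ?_⟩
  · refine hf.map' ((degreeLT F (N + 1)).subtype.compLeft γ) (LinearMap.ker_eq_bot.2 ?_)
    intro x y hxy
    ext1 j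
    exact Subtype.ext (congrFun hxy j)
  · rw [natDegree_le_iff_coeff_eq_zero]
    intro r hr
    exact (degree_lt_iff_coeff_zero _ _).1 (mem_degreeLT.1 (f i j).2) r hr
  · ext1 r
    rw [← coe_convMap, hker i]
    rfl

/-- The row degrees of any minimal basis dual to the pencil are all equal to `N`. -/
lemma ConvInjective.polyVecDeg_dual [Fintype γ] [Fintype ρ] [DecidableEq ρ] (hinj : ConvInjective Xc Yc N) (hN : 0 < N)
    (hcard : Fintype.card γ * N = Fintype.card ρ * (N + 1)) {d : ℕ}
    {Cm : Matrix (Fin d) γ F[X]} (hC : DualMinBases (pencil Xc Yc) Cm) (i : Fin d) :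
    polyVecDeg (Cm i) = N := by
  obtain ⟨G, hG⟩ := hinj.exists_right_inverse hcard
  obtain ⟨-, ⟨⟨hli, -⟩, hmin⟩, hd, hmul⟩ := hC
  rw [Fintype.card_fin] at hd
  have hker : ∀ i, pencil Xc Yc *ᵥ Cm i = 0 := by
    intro i
    ext1 r
    exact congrFun (congrFun hmul r) i
  have hge : ∀ i, N ≤ polyVecDeg (Cm i) := by
    intro i
    by_contra! hlt
    refine hli.ne_zero i ?_
    have h0 : Cm i = 0 := hinj (Cm i) ((polyVecDeg_lt_iff hN).1 hlt) (hker i)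
    change polyVec (Cm i) = 0
    rw [h0]
    ext1 j
    simp [polyVec]
  obtain ⟨b, hbF, hbdeg, hbker⟩ := exists_kernel_family Xc Yc hcard hd
  have hb := hinj.linearIndependent_polyVec hbF hbdeg hbker
  have hspan : ∀ c : Fin d → γ → F[X], LinearIndependent (RatFunc F) (fun i => polyVec (c i)) →
      (∀ i, pencil Xc Yc *ᵥ c i = 0) →
      Submodule.span (RatFunc F) (Set.range fun i => polyVec (c i)) = Nr (pencil Xc Yc) := by
    intro c hc hck
    refine Submodule.eq_of_le_of_finrank_eq (Submodule.span_le.2 ?_) ?_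
    · rintro _ ⟨i, rfl⟩
      exact polyVec_mem_Nr (hck i)
    · have := finrank_Nr_of_mul_eq_one hG
      rw [finrank_span_eq_card hc, Fintype.card_fin]
      omega
  have hsum : ∑ i, polyVecDeg (Cm i) ≤ ∑ _i : Fin d, N :=
    (hmin d b ⟨hb, (hspan b hb hbker).trans (hspan Cm hli hker).symm⟩).trans
      (Finset.sum_le_sum fun i _ => polyVecDeg_le_iff.2 (hbdeg i))
  have heq := (Finset.sum_eq_sum_iff_of_le fun i _ => hge i).1
    (le_antisymm (Finset.sum_le_sum fun i _ => hge i) hsum)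
  exact (heq i (Finset.mem_univ i)).symm

end Pencil

/-! ### perturbation bound -/

/-- Bound for the solution of the recurrence `z_{r+1,i} = x_{r+1,i} - x_{r,i+1}` with zero
boundary values, obtained by summing along the antidiagonals. -/
lemma sum_sq_le_of_antidiagonal_differences {m : ℕ} {x z : ℕ → ℕ → F}
    (hzero : ∀ i < m, z 0 i = x 0 i)
    (hsucc : ∀ r i, i < m → z (r + 1) i = x (r + 1) i - x r (i + 1)) (htop : ∀ i, x m i = 0) :
    ∑ r ∈ Finset.range m, ∑ i ∈ Finset.range (m + 1), ‖x r i‖ ^ 2 ≤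
      (m : ℝ) ^ 2 * ∑ r ∈ Finset.range (m + 1), ∑ i ∈ Finset.range m, ‖z r i‖ ^ 2 := by
  have lower : ∀ r i, r + i < m → x r i = ∑ t ∈ Finset.range (r + 1), z t (r + i - t) := by
    intro r
    induction r with
    | zero => intro i hi; simp [hzero i (by omega)]
    | succ r ih =>
      intro i hi
      rw [Finset.sum_range_succ, show r + 1 + i = r + (i + 1) by ring, ← ih (i + 1) (by omega),
        show r + (i + 1) - (r + 1) = i by omega, hsucc r i (by omega)]
      ring
  have upper : ∀ e r i, r + e = m → i ≤ m → m ≤ r + i →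
      x r i = -∑ t ∈ Finset.Ico (r + 1) (m + 1), z t (r + i - t) := by
    intro e
    induction e with
    | zero =>
      intro r i hr _ _
      obtain rfl : r = m := by omega
      simp [htop]
    | succ e ih =>
      intro r i hr hi hri
      obtain ⟨j, rfl⟩ : ∃ j, i = j + 1 := ⟨i - 1, by omega⟩
      rw [Finset.sum_eq_sum_Ico_succ_bot (by omega), show r + (j + 1) = r + 1 + j by ring,
        neg_add, ← ih (r + 1) j (by omega) (by omega) (by omega), Nat.add_sub_cancel_left,
        hsucc r j (by omega)]
      ring
  let w : ℕ → ℕ → ℝ := fun t s => if t ≤ s ∧ s - t < m then ‖z t (s - t)‖ ^ 2 else 0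
  have hw : ∀ t s, 0 ≤ w t s := by
    intro t s
    simp only [w]
    split_ifs <;> positivity
  have hsum : ∀ (S : Finset ℕ) (s : ℕ), S ⊆ Finset.range (m + 1) → S.card ≤ m →
      (∀ t ∈ S, t ≤ s ∧ s - t < m) →
      ‖∑ t ∈ S, z t (s - t)‖ ^ 2 ≤ m * ∑ t ∈ Finset.range (m + 1), w t s := by
    intro S s hS hcard hmem
    calc ‖∑ t ∈ S, z t (s - t)‖ ^ 2 ≤ (∑ t ∈ S, ‖z t (s - t)‖) ^ 2 := by
          gcongr
          exact norm_sum_le _ _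
      _ ≤ S.card * ∑ t ∈ S, ‖z t (s - t)‖ ^ 2 := sq_sum_le_card_mul_sum_sq
      _ = S.card * ∑ t ∈ S, w t s := by
          congr 1
          exact Finset.sum_congr rfl fun t ht => (if_pos (hmem t ht)).symm
      _ ≤ m * ∑ t ∈ Finset.range (m + 1), w t s := by
          gcongr
  have hx : ∀ r < m, ∀ i < m + 1, ‖x r i‖ ^ 2 ≤ m * ∑ t ∈ Finset.range (m + 1), w t (r + i) := by
    intro r hr i hi
    rcases lt_or_ge (r + i) m with h | h
    · rw [lower r i h]
      refine hsum _ _ (fun t ht => ?_) (by simpa using hr) fun t ht => ?_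
      all_goals
        simp only [Finset.mem_range] at ht ⊢
        omega
    · rw [upper (m - r) r i (by omega) (by omega) h, norm_neg]
      refine hsum _ _ (fun t ht => ?_) (by simp) fun t ht => ?_
      all_goals
        simp only [Finset.mem_range, Finset.mem_Ico] at ht ⊢
        omega
  have hrow : ∀ r t, ∑ i ∈ Finset.range (m + 1), w t (r + i) ≤
      ∑ j ∈ Finset.range m, ‖z t j‖ ^ 2 := by
    intro r t
    simp only [w]
    rw [← Finset.sum_filter]
    rw [← Finset.sum_image (f := fun j => ‖z t j‖ ^ 2) (g := fun i => r + i - t)]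
    · refine Finset.sum_le_sum_of_subset_of_nonneg ?_ fun _ _ _ => by positivity
      intro j hj
      simp only [Finset.mem_image, Finset.mem_filter, Finset.mem_range] at hj ⊢
      omega
    · intro i hi j hj hij
      simp only [Finset.coe_filter, Set.mem_ofPred_eq] at hi hj hij
      omega
  calc ∑ r ∈ Finset.range m, ∑ i ∈ Finset.range (m + 1), ‖x r i‖ ^ 2
      ≤ ∑ r ∈ Finset.range m, ∑ i ∈ Finset.range (m + 1),
          m * ∑ t ∈ Finset.range (m + 1), w t (r + i) :=
        Finset.sum_le_sum fun r hr => Finset.sum_le_sum fun i hi =>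
          hx r (Finset.mem_range.1 hr) i (Finset.mem_range.1 hi)
    _ = ∑ r ∈ Finset.range m, m * ∑ t ∈ Finset.range (m + 1),
          ∑ i ∈ Finset.range (m + 1), w t (r + i) := by
        refine Finset.sum_congr rfl fun r _ => ?_
        rw [← Finset.mul_sum, Finset.sum_comm]
    _ ≤ ∑ r ∈ Finset.range m, m * ∑ t ∈ Finset.range (m + 1),
          ∑ j ∈ Finset.range m, ‖z t j‖ ^ 2 := by
        gcongr with r _ t _
        exact hrow r t
    _ = _ := by
        rw [Finset.sum_const, Finset.card_range, nsmul_eq_mul]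
        ring

lemma vecNormSq_nonneg {ι : Type*} [Fintype ι] (x : ι → F) : 0 ≤ vecNormSq x :=
  Finset.sum_nonneg fun _ _ => by positivity

lemma vecNormSq_smul {ι : Type*} [Fintype ι] (c : F) (x : ι → F) :
    vecNormSq (c • x) = ‖c‖ ^ 2 * vecNormSq x := by
  simp [vecNormSq, mul_pow, Finset.mul_sum]

lemma vecNormSq_neg {ι : Type*} [Fintype ι] (x : ι → F) : vecNormSq (-x) = vecNormSq x := by
  simp [vecNormSq]

lemma vecNormSq_eq_zero_iff {ι : Type*} [Fintype ι] {x : ι → F} : vecNormSq x = 0 ↔ x = 0 := by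
  rw [vecNormSq, Finset.sum_eq_zero_iff_of_nonneg fun _ _ => by positivity]
  simp [funext_iff]

lemma sigmaMin_sq_mul_vecNormSq_le {ρ : Type*} [Fintype ρ] (R : Matrix ρ ρ F) (x : ρ → F) :
    sigmaMin R ^ 2 * vecNormSq x ≤ vecNormSq (R *ᵥ x) := by
  rcases (vecNormSq_nonneg x).eq_or_lt with h | h
  · rw [← h, mul_zero]
    exact vecNormSq_nonneg _
  rw [sigmaMin, if_pos le_rfl]
  set S := {r : ℝ | ∃ x : ρ → F, vecNormSq x = 1 ∧ r = Real.sqrt (vecNormSq (R *ᵥ x))}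
  have hpos : ∀ r ∈ S, 0 ≤ r := by
    rintro _ ⟨_, -, rfl⟩
    exact Real.sqrt_nonneg _
  set c : F := (((Real.sqrt (vecNormSq x))⁻¹ : ℝ) : F)
  have hc : ‖c‖ ^ 2 = (vecNormSq x)⁻¹ := by
    rw [RCLike.norm_ofReal, sq_abs, inv_pow, Real.sq_sqrt h.le]
  have hle : sInf S ≤ Real.sqrt (vecNormSq (R *ᵥ (c • x))) :=
    csInf_le ⟨0, hpos⟩ ⟨c • x, by rw [vecNormSq_smul, hc, inv_mul_cancel₀ h.ne'], rfl⟩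
  have hsq := pow_le_pow_left₀ (Real.sInf_nonneg hpos) hle 2
  rw [Real.sq_sqrt (vecNormSq_nonneg _), Matrix.mulVec_smul, vecNormSq_smul, hc,
    inv_mul_eq_div, le_div_iff₀ h] at hsq
  exact hsq

lemma vecNormSq_mulVec_add_mulVec_le {ρ γ : Type*} [Fintype ρ] [Fintype γ] (A B : Matrix ρ γ F)
    (u v : γ → F) :
    vecNormSq (A *ᵥ u + B *ᵥ v) ≤ (frobSq A + frobSq B) * (vecNormSq u + vecNormSq v) := by
  rw [frobSq, frobSq, ← Finset.sum_add_distrib, Finset.sum_mul, vecNormSq]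
  refine Finset.sum_le_sum fun i _ => ?_
  have h := Finset.sum_mul_sq_le_sq_mul_sq Finset.univ
    (Sum.elim (fun j => ‖A i j‖) (fun j => ‖B i j‖)) (Sum.elim (fun j => ‖u j‖) (fun j => ‖v j‖))
  simp only [Fintype.sum_sum_type, Sum.elim_inl, Sum.elim_inr] at h
  refine le_trans ?_ h
  gcongr
  refine (norm_add_le _ _).trans (add_le_add ?_ ?_)
  all_goals
    refine (norm_sum_le _ _).trans (Finset.sum_le_sum fun j _ => ?_)
    rw [norm_mul]

/-- The coefficient of `λ` in `B(λ)`, that is `[0 ∣ -R]`. -/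
def shiftRight {m n : ℕ} (R : Matrix (Fin m × Fin n) (Fin m × Fin n) F) :
    Matrix (Fin m × Fin n) (Fin (m + 1) × Fin n) F :=
  Matrix.of fun p q => Fin.cases 0 (fun j => -R p (j, q.2)) q.1

/-- The constant coefficient of `B(λ)`, that is `[R ∣ 0]`. -/
def shiftLeft {m n : ℕ} (R : Matrix (Fin m × Fin n) (Fin m × Fin n) F) :
    Matrix (Fin m × Fin n) (Fin (m + 1) × Fin n) F :=
  Matrix.of fun p q => Fin.lastCases 0 (fun j => R p (j, q.2)) q.1

lemma Bpencil_add_pencil {m n : ℕ} (R : Matrix (Fin m × Fin n) (Fin m × Fin n) F)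
    (ΔX ΔY : Matrix (Fin m × Fin n) (Fin (m + 1) × Fin n) F)
    {B : Matrix (Fin m × Fin n) (Fin (m + 1) × Fin n) F[X]} (hB : B = Bpencil (k := m + 1) R) :
    B + pencil ΔX ΔY = pencil (shiftRight R + ΔX) (shiftLeft R + ΔY) := by
  refine Matrix.ext fun p q => ?_
  obtain ⟨i, c⟩ := q
  have hX : (if h : 0 < (i : ℕ) then X * C (-R p (⟨(i : ℕ) - 1, by omega⟩, c)) else 0) =
      C (shiftRight R p (i, c)) * X := by
    refine Fin.cases ?_ (fun j => ?_) i
    · simp [shiftRight]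
    · simp [shiftRight, X_mul_C]
  have hY : (if h : (i : ℕ) < m then C (R p (⟨(i : ℕ), h⟩, c)) else 0) =
      C (shiftLeft R p (i, c)) := by
    refine Fin.lastCases ?_ (fun j => ?_) i
    · simp [shiftLeft]
    · simp [shiftLeft]
  have hBp : B p (i, c) = C (shiftLeft R p (i, c)) + C (shiftRight R p (i, c)) * X := by
    rw [← hX, ← hY, hB]
    rfl
  rw [Matrix.add_apply, hBp]
  simp only [pencil, Matrix.of_apply, Matrix.add_apply, C_add]
  ring

lemma shiftRight_mulVec {m n : ℕ} (R : Matrix (Fin m × Fin n) (Fin m × Fin n) F)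
    (u : Fin (m + 1) × Fin n → F) :
    shiftRight R *ᵥ u = -(R *ᵥ fun p => u (p.1.succ, p.2)) := by
  ext1 p
  simp [shiftRight, Matrix.mulVec, dotProduct, Fintype.sum_prod_type, Fin.sum_univ_succ]

lemma shiftLeft_mulVec {m n : ℕ} (R : Matrix (Fin m × Fin n) (Fin m × Fin n) F)
    (u : Fin (m + 1) × Fin n → F) :
    shiftLeft R *ᵥ u = R *ᵥ fun p => u (p.1.castSucc, p.2) := by
  ext1 p
  simp [shiftLeft, Matrix.mulVec, dotProduct, Fintype.sum_prod_type, Fin.sum_univ_castSucc]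

/-- The coefficient of `λ^r` of `([I ∣ 0] - λ [0 ∣ I]) x(λ)`, where `u r` is the coefficient of
`λ^r` of `x(λ)`. -/
def shiftDiff {m n : ℕ} (u : ℕ → Fin (m + 1) × Fin n → F) : ℕ → Fin m × Fin n → F
  | 0 => fun p => u 0 (p.1.castSucc, p.2)
  | r + 1 => fun p => u (r + 1) (p.1.castSucc, p.2) - u r (p.1.succ, p.2)

lemma sum_vecNormSq_le_shiftDiff {m n : ℕ} {u : ℕ → Fin (m + 1) × Fin n → F} (hu : u m = 0) :
    ∑ r ∈ Finset.range m, vecNormSq (u r) ≤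
      (m : ℝ) ^ 2 * ∑ r ∈ Finset.range (m + 1), vecNormSq (shiftDiff u r) := by
  have key : ∀ c : Fin n, ∑ r ∈ Finset.range m, ∑ i : Fin (m + 1), ‖u r (i, c)‖ ^ 2 ≤
      (m : ℝ) ^ 2 * ∑ r ∈ Finset.range (m + 1), ∑ i : Fin m, ‖shiftDiff u r (i, c)‖ ^ 2 := by
    intro c
    have h := sum_sq_le_of_antidiagonal_differences (m := m)
      (x := fun r i => if h : i < m + 1 then u r (⟨i, h⟩, c) else 0)
      (z := fun r i => if h : i < m then shiftDiff u r (⟨i, h⟩, c) else 0)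
      (fun i hi => by simp [hi, hi.trans (Nat.lt_succ_self m), shiftDiff])
      (fun r i hi => by simp [hi, hi.trans (Nat.lt_succ_self m), shiftDiff])
      (fun i => by simp [hu])
    simpa [Finset.sum_range, Fin.is_le] using h
  have hswap : ∀ {N M : ℕ} (v : ℕ → Fin M × Fin n → F),
      ∑ r ∈ Finset.range N, vecNormSq (v r) =
        ∑ c : Fin n, ∑ r ∈ Finset.range N, ∑ i : Fin M, ‖v r (i, c)‖ ^ 2 := by
    intro N M v
    rw [Finset.sum_comm]
    refine Finset.sum_congr rfl fun r _ => ?_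
    rw [vecNormSq, Fintype.sum_prod_type, Finset.sum_comm]
  rw [hswap, hswap, Finset.mul_sum]
  exact Finset.sum_le_sum fun c _ => key c

lemma convInjective_of_frobSq_lt {m n : ℕ} (R : Matrix (Fin m × Fin n) (Fin m × Fin n) F)
    (ΔX ΔY : Matrix (Fin m × Fin n) (Fin (m + 1) × Fin n) F)
    (hΔ : 2 * (frobSq ΔX + frobSq ΔY) * (m : ℝ) ^ 2 < sigmaMin R ^ 2) :
    ConvInjective (shiftRight R + ΔX) (shiftLeft R + ΔY) m := by
  intro x hdeg hx
  set u : ℕ → Fin (m + 1) × Fin n → F := fun r q => (x q).coeff r with hu_def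
  have hu : ∀ r, m ≤ r → u r = 0 := fun r hr => funext fun q =>
    (degree_lt_iff_coeff_zero _ _).1 (hdeg q) r hr
  have hD : 0 ≤ frobSq ΔX + frobSq ΔY := by
    unfold frobSq
    positivity
  have hR0 : R *ᵥ shiftDiff u 0 = -(ΔY *ᵥ u 0) := by
    have h : (shiftLeft R + ΔY) *ᵥ u 0 = 0 := funext fun i => by
      rw [← coeff_pencil_mulVec_zero (shiftRight R + ΔX), hx]
      simp
    rw [Matrix.add_mulVec, shiftLeft_mulVec] at h
    exact eq_neg_of_add_eq_zero_left h
  have hRs : ∀ r, R *ᵥ shiftDiff u (r + 1) = -(ΔX *ᵥ u r + ΔY *ᵥ u (r + 1)) := by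
    intro r
    have h : (shiftRight R + ΔX) *ᵥ u r + (shiftLeft R + ΔY) *ᵥ u (r + 1) = 0 :=
      funext fun i => by
        rw [Pi.add_apply, ← coeff_pencil_mulVec_succ, hx]
        simp
    rw [Matrix.add_mulVec, Matrix.add_mulVec, shiftLeft_mulVec, shiftRight_mulVec] at h
    have hdiff : shiftDiff u (r + 1) =
        (fun p => u (r + 1) (p.1.castSucc, p.2)) - fun p => u r (p.1.succ, p.2) := rfl
    rw [hdiff, Matrix.mulVec_sub, ← sub_eq_zero, ← h]
    abel
  set D := frobSq ΔX + frobSq ΔY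
  set E := ∑ r ∈ Finset.range m, vecNormSq (u r)
  set Z := ∑ r ∈ Finset.range (m + 1), vecNormSq (shiftDiff u r)
  have hEZ : E ≤ (m : ℝ) ^ 2 * Z := sum_vecNormSq_le_shiftDiff (hu m le_rfl)
  have hshift : vecNormSq (u 0) + ∑ r ∈ Finset.range m, vecNormSq (u (r + 1)) = E := by
    rw [add_comm, ← Finset.sum_range_succ' (fun r => vecNormSq (u r)), Finset.sum_range_succ,
      hu m le_rfl, vecNormSq_eq_zero_iff.2 rfl, add_zero]
  have hZE : sigmaMin R ^ 2 * Z ≤ 2 * D * E := by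
    calc sigmaMin R ^ 2 * Z
        = ∑ r ∈ Finset.range m, sigmaMin R ^ 2 * vecNormSq (shiftDiff u (r + 1)) +
            sigmaMin R ^ 2 * vecNormSq (shiftDiff u 0) := by
          rw [← Finset.mul_sum, ← mul_add, ← Finset.sum_range_succ'
            (fun r => vecNormSq (shiftDiff u r))]
      _ ≤ ∑ r ∈ Finset.range m, D * (vecNormSq (u r) + vecNormSq (u (r + 1))) +
            D * vecNormSq (u 0) := by
          refine add_le_add (Finset.sum_le_sum fun r _ => ?_) ?_
          · refine (sigmaMin_sq_mul_vecNormSq_le R _).trans ?_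
            rw [hRs, vecNormSq_neg]
            exact vecNormSq_mulVec_add_mulVec_le _ _ _ _
          · refine (sigmaMin_sq_mul_vecNormSq_le R _).trans ?_
            rw [hR0, vecNormSq_neg]
            have h := vecNormSq_mulVec_add_mulVec_le ΔX ΔY 0 (u 0)
            rwa [Matrix.mulVec_zero, zero_add, vecNormSq_eq_zero_iff.2 rfl, zero_add] at h
      _ = D * (E + (vecNormSq (u 0) + ∑ r ∈ Finset.range m, vecNormSq (u (r + 1)))) := by
          rw [← Finset.mul_sum, Finset.sum_add_distrib]
          ring
      _ = 2 * D * E := by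
          rw [hshift]
          ring
  have hE0 : 0 ≤ E := Finset.sum_nonneg fun r _ => vecNormSq_nonneg _
  have hZ0 : 0 ≤ Z := Finset.sum_nonneg fun r _ => vecNormSq_nonneg _
  have hZ : Z = 0 := by
    by_contra hne
    have hpos : 0 < Z := lt_of_le_of_ne hZ0 (Ne.symm hne)
    have h1 := mul_le_mul_of_nonneg_left hEZ (mul_nonneg zero_le_two hD)
    have h2 := mul_lt_mul_of_pos_right hΔ hpos
    linarith
  have hE : E = 0 := le_antisymm (by simpa [hZ] using hEZ) hE0
  ext q r
  rw [Pi.zero_apply, coeff_zero]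
  rcases lt_or_ge r m with hr | hr
  · have h := (Finset.sum_eq_zero_iff_of_nonneg fun r _ => vecNormSq_nonneg (u r)).1 hE r
      (Finset.mem_range.2 hr)
    exact congrFun (vecNormSq_eq_zero_iff.1 h) q
  · exact congrFun (hu r hr) q

lemma two_mul_frobSq_mul_sq_lt {ρ γ : Type*} [Fintype ρ] [Fintype γ] {A B : Matrix ρ γ F}
    {σ : ℝ} {m : ℕ} (hm : 2 ≤ m)
    (h : penFrob A B < 3 * σ / (2 * ((m + 1 : ℕ) : ℝ) ^ ((3 : ℝ) / 2))) :
    2 * (frobSq A + frobSq B) * (m : ℝ) ^ 2 < σ ^ 2 := by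
  have hD : 0 ≤ frobSq A + frobSq B := by
    unfold frobSq
    positivity
  set D := frobSq A + frobSq B with hD_def
  have hk : (0 : ℝ) < ((m + 1 : ℕ) : ℝ) := by positivity
  set κ := ((m + 1 : ℕ) : ℝ) ^ ((3 : ℝ) / 2)
  have hκ : 0 < κ := Real.rpow_pos_of_pos hk _
  have hκ2 : κ ^ 2 = ((m : ℝ) + 1) ^ 3 := by
    rw [← Real.rpow_natCast κ 2, ← Real.rpow_mul hk.le]
    norm_num
  rw [penFrob, ← hD_def, lt_div_iff₀ (by positivity)] at h
  have h0 : 0 ≤ Real.sqrt D * (2 * κ) := by positivity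
  have hσ : 0 < σ := by linarith
  have hsq : D * (4 * κ ^ 2) < 9 * σ ^ 2 := by
    have := pow_lt_pow_left₀ h h0 two_ne_zero
    rw [mul_pow, Real.sq_sqrt hD] at this
    linarith
  rw [hκ2] at hsq
  have hm' : (2 : ℝ) ≤ m := by exact_mod_cast hm
  have hpoly : 18 * (m : ℝ) ^ 2 ≤ 4 * ((m : ℝ) + 1) ^ 3 := by
    nlinarith [mul_nonneg (sub_nonneg.2 hm') (sq_nonneg (m : ℝ))]
  have hm2 : (0 : ℝ) < 2 * (m : ℝ) ^ 2 := by positivity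
  have hc : (0 : ℝ) < 4 * ((m : ℝ) + 1) ^ 3 := by positivity
  have h1 := mul_lt_mul_of_pos_right hsq hm2
  have h2 := mul_le_mul_of_nonneg_right hpoly (sq_nonneg σ)
  refine lt_of_mul_lt_mul_left ?_ hc.le
  linarith

lemma Bpencil_add_pencil_dual_degrees {m n : ℕ} (hm : 2 ≤ m)
    (R : Matrix (Fin m × Fin n) (Fin m × Fin n) F)
    (ΔX ΔY : Matrix (Fin m × Fin n) (Fin (m + 1) × Fin n) F)
    (hΔ : penFrob ΔX ΔY < 3 * sigmaMin R / (2 * ((m + 1 : ℕ) : ℝ) ^ ((3 : ℝ) / 2)))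
    {B : Matrix (Fin m × Fin n) (Fin (m + 1) × Fin n) F[X]} (hB : B = Bpencil (k := m + 1) R) :
    IsMinimalBasisMat (B + pencil ΔX ΔY) ∧ (∀ i, polyVecDeg ((B + pencil ΔX ΔY) i) = 1) ∧
    (∀ (d : ℕ) (Cm : Matrix (Fin d) (Fin (m + 1) × Fin n) F[X]),
      DualMinBases (B + pencil ΔX ΔY) Cm → ∀ i, polyVecDeg (Cm i) = m) := by
  have hinj := convInjective_of_frobSq_lt R ΔX ΔY (two_mul_frobSq_mul_sq_lt hm hΔ)
  have hcard : Fintype.card (Fin (m + 1) × Fin n) * m =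
      Fintype.card (Fin m × Fin n) * (m + 1) := by
    simp only [Fintype.card_prod, Fintype.card_fin]
    ring
  obtain ⟨G, hG⟩ := hinj.exists_right_inverse hcard
  obtain ⟨V, hV⟩ := hinj.exists_lead_right_inverse (by omega) hcard
  rw [Bpencil_add_pencil R ΔX ΔY hB]
  exact ⟨isMinimalBasisMat_pencil hV hG, polyVecDeg_pencil_row hV,
    fun d Cm hC => hinj.polyVecDeg_dual (by omega) hcard hC⟩


/-- Let `k > 2`, `R̃` nonsingular, `B(λ) = λ[0 ∣ −R̃] + [R̃ ∣ 0]`. If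
`ΔB(λ) = λ ΔX + ΔY` satisfies `‖ΔB‖_F < 3σ_min(R̃)/(2k^{3/2})`, then `B + ΔB` is a
minimal basis with all row degrees equal to `1`, and all row degrees of any minimal
basis dual to it are equal to `k−1`. -/
theorem statement_15 {F : Type*} [RCLike F] {k n : ℕ} (hk : 2 < k)
    (R : Matrix (Fin (k - 1) × Fin n) (Fin (k - 1) × Fin n) F) (hR : IsUnit R)
    (ΔX ΔY : Matrix (Fin (k - 1) × Fin n) (Fin k × Fin n) F)
    (hΔ : penFrob ΔX ΔY < 3 * sigmaMin R / (2 * (k : ℝ) ^ ((3 : ℝ) / 2))) :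
    IsMinimalBasisMat (Bpencil R + pencil ΔX ΔY) ∧
    (∀ i, polyVecDeg ((Bpencil R + pencil ΔX ΔY) i) = 1) ∧
    (∀ (d : ℕ) (Cm : Matrix (Fin d) (Fin k × Fin n) F[X]),
      DualMinBases (Bpencil R + pencil ΔX ΔY) Cm → ∀ i, polyVecDeg (Cm i) = k - 1) := by
  obtain ⟨m, rfl⟩ : ∃ m, k = m + 1 := ⟨k - 1, by omega⟩
  exact Bpencil_add_pencil_dual_degrees (by omega) R ΔX ΔY hΔ rfl
end GLin
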